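/- Fixed-point lemma with greatest element: Let 𝒬 be a nonempty, convex, compact subset of the symmetric d×d matrices with a greatest element with respect to the Loewner order, and let Ψ : 𝒬 → 𝒬 be continuous and order-preserving. Then the fixed-point set FP = {η ∈ 𝒬 : Ψ(η) = η} is nonempty and has a greatest element η⋆, i.e., η ⪯ η⋆ for all η ∈ FP. -/

import Mathlib

open Matrix

section OrderedTopology

open Filter Topology

/-- A continuous monotone self-map of a compact set with a greatest element, in an ordered
first-countable space, has a greatest fixed point: every cluster point of the iterates of the
greatest element is one. -/
theorem IsCompact.exists_isGreatest_fixedPoints {α : Type*} [TopologicalSpace α]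
    [FirstCountableTopology α] [PartialOrder α] [OrderClosedTopology α] {s : Set α} {f : α → α}
    {g : α} (hs : IsCompact s) (hg : IsGreatest s g) (hmaps : Set.MapsTo f s s)
    (hcont : ContinuousOn f s) (hmono : MonotoneOn f s) :
    ∃ a, IsGreatest {x | x ∈ s ∧ f x = x} a := by
  have hmem : ∀ n, f^[n] g ∈ s := fun n => hmaps.iterate n hg.1
  have hanti : Antitone fun n => f^[n] g := by
    refine antitone_nat_of_succ_le fun n => ?_
    induction n with
    | zero => exact hg.2 (hmem 1)
    | succ n ih =>
      have h := hmono (hmem (n + 1)) (hmem n) ih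
      rwa [← Function.iterate_succ_apply' f, ← Function.iterate_succ_apply' f] at h
  obtain ⟨a, ha, φ, hφ, hlim⟩ := hs.tendsto_subseq hmem
  have hle : ∀ n, a ≤ f^[n] g := fun n =>
    le_of_tendsto hlim <| (hφ.tendsto_atTop.eventually_ge_atTop n).mono fun _ hk => hanti hk
  have hflim : Tendsto (fun k => f (f^[φ k] g)) atTop (𝓝 (f a)) :=
    (hcont a ha).tendsto.comp <|
      tendsto_nhdsWithin_iff.2 ⟨hlim, Eventually.of_forall fun k => hmem (φ k)⟩
  have hfix : f a = a := by
    refine le_antisymm (le_of_tendsto_of_tendsto' hflim hlim fun k => ?_)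
      (ge_of_tendsto' hflim fun k => ?_)
    · rw [← Function.iterate_succ_apply' f]
      exact hanti (Nat.le_succ _)
    · rw [← Function.iterate_succ_apply' f]
      exact hle _
  refine ⟨a, ⟨ha, hfix⟩, fun x ⟨hx, hfx⟩ => ge_of_tendsto' hlim fun k => ?_⟩
  change x ≤ f^[φ k] g
  induction φ k with
  | zero => exact hg.2 hx
  | succ n ih =>
    have h := hmono hx (hmem n) ih
    rwa [hfx, ← Function.iterate_succ_apply' f] at h

end OrderedTopology

section Loewner

open scoped MatrixOrder

theorem Matrix.isClosed_setOf_posSemidef {n : Type*} [Fintype n] :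
    IsClosed {A : Matrix n n ℝ | A.PosSemidef} := by
  simp only [Matrix.posSemidef_iff_dotProduct_mulVec, Set.ofPred_and, Set.ofPred_forall]
  refine IsClosed.inter (isClosed_eq (by fun_prop) (by fun_prop)) (isClosed_iInter fun x => ?_)
  exact isClosed_le continuous_const (by fun_prop)

theorem Matrix.orderClosedTopology_loewner {n : Type*} [Fintype n] :
    OrderClosedTopology (Matrix n n ℝ) where
  isClosed_le' := Matrix.isClosed_setOf_posSemidef.preimage (continuous_snd.sub continuous_fst)

/-- The greatest fixed point principle for the Loewner order on a compact set of matrices. -/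
theorem Matrix.exists_isGreatest_fixedPoints_loewner {n : Type*} [Fintype n]
    {s : Set (Matrix n n ℝ)} {f : Matrix n n ℝ → Matrix n n ℝ} {g : Matrix n n ℝ}
    (hs : IsCompact s) (hg : IsGreatest s g) (hmaps : Set.MapsTo f s s)
    (hcont : ContinuousOn f s) (hmono : MonotoneOn f s) :
    ∃ a, IsGreatest {x | x ∈ s ∧ f x = x} a :=
  haveI : OrderClosedTopology (Matrix n n ℝ) := Matrix.orderClosedTopology_loewner
  haveI : FirstCountableTopology (Matrix n n ℝ) :=
    inferInstanceAs (FirstCountableTopology (n → n → ℝ))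
  hs.exists_isGreatest_fixedPoints hg hmaps hcont hmono

end Loewner

/-- Fixed-point lemma with greatest element: a continuous order-preserving self-map of a
nonempty convex compact set of symmetric matrices having a greatest element (Loewner order)
has a nonempty fixed-point set with a greatest element. -/
theorem greatest_fixed_point
    (d : ℕ) (Q : Set (Matrix (Fin d) (Fin d) ℝ))
    (Ψ : Matrix (Fin d) (Fin d) ℝ → Matrix (Fin d) (Fin d) ℝ)
    (hne : Q.Nonempty) (hconv : Convex ℝ Q) (hcomp : IsCompact Q)
    (hsymm : ∀ A ∈ Q, A.IsSymm)
    (hgreatest : ∃ g ∈ Q, ∀ η ∈ Q, (g - η).PosSemidef)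
    (hmaps : ∀ η ∈ Q, Ψ η ∈ Q)
    (hcont : ContinuousOn Ψ Q)
    (hmono : ∀ η₁ ∈ Q, ∀ η₂ ∈ Q, (η₂ - η₁).PosSemidef → (Ψ η₂ - Ψ η₁).PosSemidef) :
    ∃ ηs ∈ Q, Ψ ηs = ηs ∧ ∀ η ∈ Q, Ψ η = η → (ηs - η).PosSemidef := by
  obtain ⟨g, hgQ, hg⟩ := hgreatest
  obtain ⟨a, ⟨haQ, hfix⟩, ha⟩ := Matrix.exists_isGreatest_fixedPoints_loewner hcomp
    ⟨hgQ, fun η hη => hg η hη⟩ (fun η hη => hmaps η hη) hcont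
    (fun η₁ h₁ η₂ h₂ h => hmono η₁ h₁ η₂ h₂ h)
  exact ⟨a, haQ, hfix, fun η hη hη_fix => ha ⟨hη, hη_fix⟩⟩
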